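/- (Gaussian L_p Poincaré inequality, scalar case) Let γ_d be the standard Gaussian measure on ℝ^d and let 2 ≤ p < ∞. Then for every bounded C¹ function f on ℝ^d with |∇f| of polynomial growth, ‖f − ∫ f dγ_d‖_{L_p(γ_d)} ≤ C√p · ‖|∇f|‖_{L_p(γ_d)} for a universal constant C. -/

import Mathlib

open MeasureTheory ProbabilityTheory
open scoped ENNReal NNReal

lemma aux_jensen {α : Type*} [MeasurableSpace α] (μ : Measure α) (p : ℝ) (hp : 1 ≤ p)
    (h : α → ℝ≥0∞) (hm : AEMeasurable h μ) :
    (∫⁻ a, h a ∂μ) ^ p ≤ (μ Set.univ) ^ (p - 1) * ∫⁻ a, h a ^ p ∂μ := by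
  have h0 : 0 < p := by linarith
  have := eLpNorm'_le_eLpNorm'_mul_rpow_measure_univ (f := h) (μ := μ) (p := 1) (q := p)
    one_pos hp hm.aestronglyMeasurable
  rw [eLpNorm'_eq_lintegral_enorm, eLpNorm'_eq_lintegral_enorm] at this
  simp only [enorm_eq_self, ENNReal.rpow_one, div_one] at this
  have h2 := ENNReal.rpow_le_rpow this h0.le
  rw [ENNReal.mul_rpow_of_nonneg _ _ h0.le, ← ENNReal.rpow_mul, ← ENNReal.rpow_mul,
    one_div_mul_cancel h0.ne', ENNReal.rpow_one,
    show (1 - 1 / p) * p = p - 1 by field_simp] at h2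
  rwa [mul_comm]

instance aux_isGaussian (d : ℕ) : IsGaussian (Measure.pi fun _ : Fin d => gaussianReal 0 1) := by
  have h := map_pi_eq_stdGaussian (ι := Fin d)
  rw [← isGaussian_map_equiv_iff (EuclideanSpace.equiv (Fin d) ℝ).symm]
  have : (Measure.pi fun _ : Fin d => gaussianReal 0 1).map (EuclideanSpace.equiv (Fin d) ℝ).symm
    = stdGaussian (EuclideanSpace ℝ (Fin d)) := h
  rw [this]
  infer_instance

lemma aux_mean (d : ℕ) : ∫ x, id x ∂(Measure.pi fun _ : Fin d => gaussianReal 0 1) = 0 := by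
  have hi : Integrable id (Measure.pi fun _ : Fin d => gaussianReal 0 1) :=
    IsGaussian.integrable_id
  ext i
  have := (ContinuousLinearMap.proj (R := ℝ) (φ := fun _ : Fin d => ℝ) i).integral_comp_comm hi
  simp only [ContinuousLinearMap.proj_apply] at this
  rw [← this]
  have := integral_comp_eval (μ := fun _ : Fin d => gaussianReal 0 1) (i := i) (f := fun x => x)
    (by fun_prop)
  simpa using this

lemma aux_moment1 (p : ℝ) (hp : 2 ≤ p) :
    ∫⁻ t, ‖t‖ₑ ^ p ∂(gaussianReal 0 1) ≤ ENNReal.ofReal (4 * √p) ^ p := by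
  have h0 : 0 < p := by linarith
  have hs : 0 < √p := Real.sqrt_pos.2 h0
  have hss : √p * √p = p := Real.mul_self_sqrt h0.le
  have key : ∀ t : ℝ, |t| ^ p ≤ √p ^ p * (Real.exp (√p * t) + Real.exp (-√p * t)) := by
    intro t
    have h1 : |t| ≤ √p * Real.exp (|t| / √p) := by
      have := Real.add_one_le_exp (|t| / √p)
      have h2 : |t| = √p * (|t| / √p) := by field_simp
      calc |t| = √p * (|t| / √p) := h2
        _ ≤ _ := by gcongr; linarith
    calc |t| ^ p ≤ (√p * Real.exp (|t| / √p)) ^ p := by gcongr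
      _ = √p ^ p * Real.exp (√p * |t|) := by
        rw [Real.mul_rpow hs.le (Real.exp_pos _).le, ← Real.exp_mul]
        congr 2
        rw [div_mul_eq_mul_div, div_eq_iff hs.ne']
        nlinarith [abs_nonneg t]
      _ ≤ _ := by
        gcongr
        rcases abs_cases t with ⟨h, _⟩ | ⟨h, _⟩ <;> rw [h]
        · linarith [Real.exp_pos (-√p * t)]
        · rw [mul_neg, ← neg_mul]; linarith [Real.exp_pos (√p * t)]
  have hi1 := integrable_exp_mul_gaussianReal (μ := 0) (v := 1) (√p)
  have hi2 := integrable_exp_mul_gaussianReal (μ := 0) (v := 1) (-√p)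
  have m : ∀ s, ∫ x, Real.exp (s * x) ∂(gaussianReal 0 1) = Real.exp (s ^ 2 / 2) := by
    intro s
    have := congrFun (mgf_id_gaussianReal (μ := 0) (v := 1)) s
    simpa [mgf] using this
  have hsq : √p ^ 2 = p := Real.sq_sqrt h0.le
  calc ∫⁻ t, ‖t‖ₑ ^ p ∂(gaussianReal 0 1)
      ≤ ∫⁻ t, ENNReal.ofReal (√p ^ p * (Real.exp (√p * t) + Real.exp (-√p * t)))
          ∂(gaussianReal 0 1) := by
        gcongr with t
        rw [Real.enorm_eq_ofReal_abs, ENNReal.ofReal_rpow_of_nonneg (abs_nonneg _) h0.le]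
        exact ENNReal.ofReal_le_ofReal (key t)
    _ = ENNReal.ofReal (√p ^ p * (2 * Real.exp (p / 2))) := by
        rw [← ofReal_integral_eq_lintegral_ofReal
          (f := fun t => √p ^ p * (Real.exp (√p * t) + Real.exp (-√p * t))) ((hi1.add hi2).const_mul _)
          (ae_of_all _ fun t => by positivity)]
        rw [integral_const_mul, integral_add hi1 hi2, m, m, neg_sq, hsq, two_mul]
    _ ≤ ENNReal.ofReal ((4 * √p) ^ p) := by
        apply ENNReal.ofReal_le_ofReal
        rw [Real.mul_rpow (by norm_num) hs.le, mul_comm]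
        gcongr
        have e1 : Real.exp (p / 2) ≤ 2 ^ p := by
          rw [Real.rpow_def_of_pos (by norm_num)]
          gcongr
          nlinarith [Real.log_two_gt_d9]
        have e2 : (2 : ℝ) ≤ 2 ^ p := by
          calc (2 : ℝ) = 2 ^ (1 : ℝ) := by simp
            _ ≤ _ := by gcongr <;> linarith
        calc 2 * Real.exp (p / 2) ≤ 2 ^ p * 2 ^ p := by gcongr
          _ = 4 ^ p := by rw [← Real.mul_rpow (by norm_num) (by norm_num)]; norm_num
    _ = _ := by rw [ENNReal.ofReal_rpow_of_nonneg (by positivity) h0.le]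

lemma aux_var (d : ℕ) (L : (Fin d → ℝ) →L[ℝ] ℝ) :
    Var[L; Measure.pi fun _ : Fin d => gaussianReal 0 1] = ∑ i, (L (Pi.single i 1)) ^ 2 := by
  have : (L : (Fin d → ℝ) → ℝ) = ∑ i, (fun x : Fin d → ℝ => L (Pi.single i 1) * x i) := by
    ext x
    rw [Finset.sum_apply]
    conv_lhs => rw [← Finset.univ_sum_single x, map_sum]
    refine Finset.sum_congr rfl fun i _ => ?_
    rw [show (Pi.single i (x i) : Fin d → ℝ) = x i • Pi.single i 1 by
      rw [← Pi.single_smul]; simp, map_smul, smul_eq_mul, mul_comm]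
  rw [this, variance_sum_pi (X := fun i t => L (Pi.single i 1) * t)]
  · rw [← this]
    change ∑ i, Var[fun x ↦ _ * (id x); gaussianReal 0 1] = _
    simp_rw [variance_const_mul, variance_id_gaussianReal]
    simp
  · exact fun i ↦ IsGaussian.memLp_two_id.const_mul _

lemma aux_moment (d : ℕ) (p : ℝ) (hp : 2 ≤ p) (L : (Fin d → ℝ) →L[ℝ] ℝ) :
    ∫⁻ y, ‖L y‖ₑ ^ p ∂(Measure.pi fun _ : Fin d => gaussianReal 0 1) ≤
      ENNReal.ofReal (4 * √p) ^ p * ENNReal.ofReal (√(∑ i, (L (Pi.single i 1)) ^ 2)) ^ p := by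
  set γ := Measure.pi fun _ : Fin d => gaussianReal 0 1
  have h0 : 0 < p := by linarith
  set v := ∑ i, (L (Pi.single i 1)) ^ 2
  have hv : 0 ≤ v := Finset.sum_nonneg fun i _ => sq_nonneg _
  have h1 : γ.map L = (gaussianReal 0 1).map (√v * ·) := by
    rw [IsGaussian.map_eq_gaussianReal L, gaussianReal_map_const_mul, aux_var]
    rw [IsGaussian.integral_dual]
    have := aux_mean d
    simp only [id] at this
    rw [this]
    simp only [map_zero, mul_zero, mul_one]
    congr 1
    ext
    simp [hv, v]
  calc ∫⁻ y, ‖L y‖ₑ ^ p ∂γ = ∫⁻ t, ‖t‖ₑ ^ p ∂(γ.map L) := by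
        rw [lintegral_map (by fun_prop) (by fun_prop)]
    _ = ∫⁻ t, ENNReal.ofReal (√v) ^ p * ‖t‖ₑ ^ p ∂(gaussianReal 0 1) := by
        rw [h1, lintegral_map (by fun_prop) (by fun_prop)]
        refine lintegral_congr fun t => ?_
        rw [enorm_mul, ENNReal.mul_rpow_of_nonneg _ _ h0.le, Real.enorm_of_nonneg (Real.sqrt_nonneg _)]
    _ = ENNReal.ofReal (√v) ^ p * ∫⁻ t, ‖t‖ₑ ^ p ∂(gaussianReal 0 1) := by
        rw [lintegral_const_mul _ (by fun_prop)]
    _ ≤ _ := by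
        rw [mul_comm]
        gcongr
        exact aux_moment1 p hp

lemma aux_path (d : ℕ) (f : (Fin d → ℝ) → ℝ) (hf : ContDiff ℝ 1 f)
    (z : (Fin d → ℝ) × (Fin d → ℝ)) :
    ‖f z.1 - f z.2‖ₑ ≤ ∫⁻ θ in Set.Ioc 0 (Real.pi / 2),
      ‖fderiv ℝ f (ContinuousLinearMap.rotation θ z).1 (ContinuousLinearMap.rotation θ z).2‖ₑ := by
  have hd : Differentiable ℝ f := hf.differentiable one_ne_zero
  have hc : Continuous (fderiv ℝ f) := hf.continuous_fderiv one_ne_zero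
  simp only [ContinuousLinearMap.rotation_apply]
  have hder : ∀ θ : ℝ, HasDerivAt (fun θ : ℝ => f (Real.cos θ • z.1 + Real.sin θ • z.2))
      (fderiv ℝ f (Real.cos θ • z.1 + Real.sin θ • z.2)
        (-Real.sin θ • z.1 + Real.cos θ • z.2)) θ := by
    intro θ
    exact (hd _).hasFDerivAt.comp_hasDerivAt θ
      (((Real.hasDerivAt_cos θ).smul_const z.1).add ((Real.hasDerivAt_sin θ).smul_const z.2))
  have hcont : Continuous fun θ : ℝ => fderiv ℝ f (Real.cos θ • z.1 + Real.sin θ • z.2)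
        (-Real.sin θ • z.1 + Real.cos θ • z.2) := by
    apply Continuous.clm_apply <;> fun_prop
  have := intervalIntegral.integral_eq_sub_of_hasDerivAt (a := 0) (b := Real.pi / 2)
    (fun θ _ => hder θ) (hcont.intervalIntegrable _ _)
  simp only [Real.cos_pi_div_two, Real.sin_pi_div_two, Real.cos_zero, Real.sin_zero, zero_smul,
    one_smul, zero_add, add_zero] at this
  rw [← enorm_neg, neg_sub, ← this, intervalIntegral.integral_of_le (by positivity)]
  exact enorm_integral_le_lintegral_enorm _

lemma aux_main (d : ℕ) (p : ℝ) (hp : 2 ≤ p) (f : (Fin d → ℝ) → ℝ) (hf : ContDiff ℝ 1 f)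
    (hb : ∃ M : ℝ, ∀ x, |f x| ≤ M) :
    ∫⁻ x, ‖f x - ∫ y, f y ∂(Measure.pi fun _ : Fin d => gaussianReal 0 1)‖ₑ ^ p
        ∂(Measure.pi fun _ : Fin d => gaussianReal 0 1) ≤
      ENNReal.ofReal (2 * Real.pi * √p) ^ p *
      ∫⁻ x, ENNReal.ofReal (√(∑ i, (fderiv ℝ f x (Pi.single i 1)) ^ 2)) ^ p
        ∂(Measure.pi fun _ : Fin d => gaussianReal 0 1) := by
  have h0 : 0 < p := by linarith
  have h1 : 1 ≤ p := by linarith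
  have hc : Continuous (fderiv ℝ f) := hf.continuous_fderiv one_ne_zero
  have hfc : Continuous f := hf.continuous
  have hmean := aux_mean d
  have hmom := aux_moment d p hp
  have hg := aux_isGaussian d
  set γ := Measure.pi fun _ : Fin d => gaussianReal 0 1 with hγ
  have hint : Integrable f γ := by
    obtain ⟨M, hM⟩ := hb
    exact Integrable.of_bound hfc.aestronglyMeasurable M (ae_of_all _ hM)
  let H : (Fin d → ℝ) × (Fin d → ℝ) → ℝ≥0∞ := fun z => ‖fderiv ℝ f z.1 z.2‖ₑ
  have hHc : Continuous H := by
    apply Continuous.enorm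
    apply Continuous.clm_apply <;> fun_prop
  have hHm : Measurable H := hHc.measurable
  have hrotc : Continuous fun q : ((Fin d → ℝ) × (Fin d → ℝ)) × ℝ =>
      ContinuousLinearMap.rotation q.2 q.1 := by
    simp only [ContinuousLinearMap.rotation_apply]
    fun_prop
  have hHrm : Measurable fun q : ((Fin d → ℝ) × (Fin d → ℝ)) × ℝ =>
      H (ContinuousLinearMap.rotation q.2 q.1) := (hHc.comp hrotc).measurable
  set ν : Measure ℝ := volume.restrict (Set.Ioc 0 (Real.pi / 2)) with hν
  have hνu : ν Set.univ = ENNReal.ofReal (Real.pi / 2) := by simp [hν]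
  have hpi : ENNReal.ofReal (Real.pi / 2) ≠ 0 := by
    simp [Real.pi_pos]
  calc ∫⁻ x, ‖f x - ∫ y, f y ∂γ‖ₑ ^ p ∂γ
      ≤ ∫⁻ x, ∫⁻ y, ‖f x - f y‖ₑ ^ p ∂γ ∂γ := by
        gcongr with x
        have e : f x - ∫ y, f y ∂γ = ∫ y, (f x - f y) ∂γ := by
          rw [integral_sub (integrable_const _) hint]; simp
        rw [e]
        calc ‖∫ y, (f x - f y) ∂γ‖ₑ ^ p ≤ (∫⁻ y, ‖f x - f y‖ₑ ∂γ) ^ p := by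
              gcongr
              exact enorm_integral_le_lintegral_enorm _
          _ ≤ _ := by
              have := aux_jensen γ p h1 (fun y => ‖f x - f y‖ₑ) (by fun_prop)
              simpa using this
    _ = ∫⁻ z, ‖f z.1 - f z.2‖ₑ ^ p ∂(γ.prod γ) := by
        rw [lintegral_prod _ (by fun_prop)]
    _ ≤ ∫⁻ z, (∫⁻ θ, H (ContinuousLinearMap.rotation θ z) ∂ν) ^ p ∂(γ.prod γ) := by
        gcongr with z
        exact aux_path d f hf z
    _ ≤ ∫⁻ z, ENNReal.ofReal (Real.pi / 2) ^ (p - 1) *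
          ∫⁻ θ, H (ContinuousLinearMap.rotation θ z) ^ p ∂ν ∂(γ.prod γ) := by
        gcongr with z
        rw [← hνu]
        exact aux_jensen ν p h1 _ (hHrm.comp measurable_prodMk_left).aemeasurable
    _ = ENNReal.ofReal (Real.pi / 2) ^ (p - 1) *
          ∫⁻ z, ∫⁻ θ, H (ContinuousLinearMap.rotation θ z) ^ p ∂ν ∂(γ.prod γ) := by
        rw [lintegral_const_mul]
        exact (hHrm.pow_const p).lintegral_prod_right'
    _ = ENNReal.ofReal (Real.pi / 2) ^ (p - 1) *
          ∫⁻ θ, ∫⁻ z, H (ContinuousLinearMap.rotation θ z) ^ p ∂(γ.prod γ) ∂ν := by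
        rw [lintegral_lintegral_swap]
        exact (hHrm.pow_const p).aemeasurable
    _ = ENNReal.ofReal (Real.pi / 2) ^ (p - 1) *
          ∫⁻ θ, ∫⁻ z, H z ^ p ∂(γ.prod γ) ∂ν := by
        congr 1
        refine lintegral_congr fun θ => ?_
        conv_rhs => rw [← IsGaussian.map_rotation_eq_self hmean θ]
        rw [lintegral_map (hHm.pow_const p) (by fun_prop)]
    _ = ENNReal.ofReal (Real.pi / 2) ^ p * ∫⁻ z, H z ^ p ∂(γ.prod γ) := by
        rw [lintegral_const, hνu, mul_comm (lintegral _ _), ← mul_assoc]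
        congr 1
        conv_lhs => rw [← ENNReal.rpow_one (ENNReal.ofReal (Real.pi / 2)), ← ENNReal.rpow_mul]
        rw [← ENNReal.rpow_add _ _ hpi ENNReal.ofReal_ne_top]
        congr 1; ring
    _ = ENNReal.ofReal (Real.pi / 2) ^ p * ∫⁻ x, ∫⁻ y, ‖fderiv ℝ f x y‖ₑ ^ p ∂γ ∂γ := by
        rw [lintegral_prod _ (hHm.pow_const p).aemeasurable]
    _ ≤ ENNReal.ofReal (Real.pi / 2) ^ p * ∫⁻ x, ENNReal.ofReal (4 * √p) ^ p *
          ENNReal.ofReal (√(∑ i, (fderiv ℝ f x (Pi.single i 1)) ^ 2)) ^ p ∂γ := by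
        gcongr with x
        exact hmom _
    _ = _ := by
        rw [lintegral_const_mul, ← mul_assoc, ← ENNReal.mul_rpow_of_nonneg _ _ h0.le,
          ← ENNReal.ofReal_mul (by positivity)]
        · congr 3; ring
        · fun_prop

lemma aux_memLp (d : ℕ) (q : ℝ≥0∞) (hq : q ≠ ∞) :
    MemLp (fun x : Fin d → ℝ => 1 + ‖x‖) q (Measure.pi fun _ : Fin d => gaussianReal 0 1) := by
  have h1 : MemLp (fun x : Fin d → ℝ => ‖x‖) q (Measure.pi fun _ : Fin d => gaussianReal 0 1) :=
    MemLp.norm (f := fun x => x) (IsGaussian.memLp_id _ q hq)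
  have h2 : MemLp (fun x : Fin d → ℝ => (1 : ℝ)) q
    (Measure.pi fun _ : Fin d => gaussianReal 0 1) := memLp_const 1
  exact h2.add h1

theorem stmt15 :
    ∃ C : ℝ, 0 < C ∧
      ∀ (d : ℕ) (p : ℝ), 2 ≤ p →
        ∀ f : (Fin d → ℝ) → ℝ, ContDiff ℝ 1 f →
          (∃ M : ℝ, ∀ x, |f x| ≤ M) →
          (∃ (c : ℝ) (n : ℕ), ∀ x,
            Real.sqrt (∑ i, (fderiv ℝ f x (Pi.single i 1)) ^ 2) ≤ c * (1 + ‖x‖) ^ n) →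
          (∫ x, |f x - ∫ y, f y ∂(Measure.pi fun _ : Fin d => gaussianReal 0 1)| ^ p
              ∂(Measure.pi fun _ : Fin d => gaussianReal 0 1)) ^ (1 / p) ≤
            C * Real.sqrt p *
              (∫ x, (Real.sqrt (∑ i, (fderiv ℝ f x (Pi.single i 1)) ^ 2)) ^ p
                ∂(Measure.pi fun _ : Fin d => gaussianReal 0 1)) ^ (1 / p) := by
  refine ⟨2 * Real.pi, by positivity, fun d p hp f hf hb hgr => ?_⟩
  have hmain := aux_main d p hp f hf hb
  have h0 : 0 < p := by linarith
  have hc : Continuous (fderiv ℝ f) := hf.continuous_fderiv one_ne_zero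
  have hfc : Continuous f := hf.continuous
  have hg := aux_isGaussian d
  set γ := Measure.pi fun _ : Fin d => gaussianReal 0 1 with hγ
  set G : (Fin d → ℝ) → ℝ := fun x => √(∑ i, (fderiv ℝ f x (Pi.single i 1)) ^ 2) with hG
  have hGc : Continuous G := by fun_prop
  have hG0 : ∀ x, 0 ≤ G x := fun x => Real.sqrt_nonneg _
  have hGi : Integrable (fun x => G x ^ p) γ := by
    obtain ⟨c, n, hcn⟩ := hgr
    have hm := aux_memLp d (ENNReal.ofReal ((n + 1) * p)) ENNReal.ofReal_ne_top
    have hi := hm.integrable_norm_rpow (by simp; positivity) ENNReal.ofReal_ne_top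
    rw [ENNReal.toReal_ofReal (by positivity)] at hi
    refine (hi.const_mul (|c| ^ p)).mono' (by
      exact (hGc.rpow_const fun _ => Or.inr h0.le).aestronglyMeasurable) (ae_of_all _ fun x => ?_)
    rw [Real.norm_of_nonneg (Real.rpow_nonneg (hG0 x) _),
      Real.norm_of_nonneg (by positivity), Real.rpow_mul (by positivity),
      ← Real.mul_rpow (by positivity) (by positivity)]
    refine Real.rpow_le_rpow (hG0 x) ?_ h0.le
    calc G x ≤ c * (1 + ‖x‖) ^ n := hcn x
      _ ≤ |c| * (1 + ‖x‖) ^ n := by gcongr; exact le_abs_self c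
      _ ≤ |c| * (1 + ‖x‖) ^ (n + 1) := by
        gcongr
        · linarith [norm_nonneg x]
        · simp
      _ = _ := by norm_cast
  have hR : ∫⁻ x, ENNReal.ofReal (G x) ^ p ∂γ = ENNReal.ofReal (∫ x, G x ^ p ∂γ) := by
    rw [ofReal_integral_eq_lintegral_ofReal hGi (ae_of_all _ fun x => Real.rpow_nonneg (hG0 x) _)]
    refine lintegral_congr fun x => ?_
    rw [ENNReal.ofReal_rpow_of_nonneg (hG0 x) h0.le]
  have hI0 : 0 ≤ ∫ x, G x ^ p ∂γ := integral_nonneg fun x => Real.rpow_nonneg (hG0 x) _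
  have hL : ∫ x, |f x - ∫ y, f y ∂γ| ^ p ∂γ ≤ (2 * Real.pi * √p) ^ p * ∫ x, G x ^ p ∂γ := by
    rw [integral_eq_lintegral_of_nonneg_ae (ae_of_all _ fun x => by positivity)
      (by
        refine Continuous.aestronglyMeasurable ?_
        exact Continuous.rpow_const (by fun_prop) fun _ => Or.inr h0.le)]
    refine ENNReal.toReal_le_of_le_ofReal (by positivity) ?_
    rw [ENNReal.ofReal_mul (by positivity), ← hR,
      ← ENNReal.ofReal_rpow_of_nonneg (by positivity) h0.le]
    refine le_trans (le_of_eq ?_) hmain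
    refine lintegral_congr fun x => ?_
    rw [Real.enorm_eq_ofReal_abs, ENNReal.ofReal_rpow_of_nonneg (abs_nonneg _) h0.le]
  calc (∫ x, |f x - ∫ y, f y ∂γ| ^ p ∂γ) ^ (1 / p)
      ≤ ((2 * Real.pi * √p) ^ p * ∫ x, G x ^ p ∂γ) ^ (1 / p) :=
        Real.rpow_le_rpow (integral_nonneg fun x => by positivity) hL (by positivity)
    _ = _ := by
        rw [Real.mul_rpow (by positivity) hI0, ← Real.rpow_mul (by positivity),
          mul_one_div_cancel h0.ne', Real.rpow_one]
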